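/- arXiv:math/0302196 — 8 statements merged into one kernel-verified Lean document; each statement's English description precedes it below -/
import Mathlib

section
/- Let k, a, b, c ∈ ℝ with k ≠ 0 and let z(x,y) = (k/2)(x² + y²) + (a/6)x³ + (b/2)x y² + (c/6)y³. Let K and H be the Gaussian and mean curvatures of the graph of z. Then the harmonic mean curvature K/H satisfies (K/H)(0,0) = k = H(0,0), and the total derivative (Fréchet derivative) of K/H at (0,0) equals the total derivative of H at (0,0); that is, K/H and H have the same 1-jet at the umbilic point (0,0). -/
lemma hasFDerivAt_div_aux {f g : ℝ × ℝ → ℝ} {f' g' : ℝ × ℝ →L[ℝ] ℝ} {p : ℝ × ℝ}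
    (hf : HasFDerivAt f f' p) (hg : HasFDerivAt g g' p) (h : g p ≠ 0) :
    HasFDerivAt (fun q => f q / g q) ((g p)⁻¹ • f' - (f p / (g p) ^ 2) • g') p := by
  have hi := (hasDerivAt_inv h).comp_hasFDerivAt p hg
  simp only [div_eq_mul_inv]
  refine (hf.mul hi).congr_fderiv ?_
  ext <;> simp <;> ring

theorem harmonic_mean_curvature_same_one_jet_as_mean_curvature_at_umbilic
    (k a b c : ℝ) (hk : k ≠ 0) (z zx zy zxx zxy zyy Kg Hm : ℝ → ℝ → ℝ)
    (hz : ∀ x y, z x y = k / 2 * (x ^ 2 + y ^ 2) + a / 6 * x ^ 3 + b / 2 * x * y ^ 2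
      + c / 6 * y ^ 3)
    (hzx : ∀ x y, zx x y = deriv (fun t => z t y) x)
    (hzy : ∀ x y, zy x y = deriv (fun t => z x t) y)
    (hzxx : ∀ x y, zxx x y = deriv (fun t => zx t y) x)
    (hzxy : ∀ x y, zxy x y = deriv (fun t => zx x t) y)
    (hzyy : ∀ x y, zyy x y = deriv (fun t => zy x t) y)
    (hKg : ∀ x y, Kg x y =
      (zxx x y * zyy x y - zxy x y ^ 2) / (1 + zx x y ^ 2 + zy x y ^ 2) ^ 2)
    (hHm : ∀ x y, Hm x y =
      ((1 + zy x y ^ 2) * zxx x y - 2 * zx x y * zy x y * zxy x y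
        + (1 + zx x y ^ 2) * zyy x y) /
      (2 * (1 + zx x y ^ 2 + zy x y ^ 2) ^ ((3 : ℝ) / 2))) :
    Kg 0 0 / Hm 0 0 = k ∧ Hm 0 0 = k ∧
      fderiv ℝ (fun p : ℝ × ℝ => Kg p.1 p.2 / Hm p.1 p.2) (0, 0) =
        fderiv ℝ (fun p : ℝ × ℝ => Hm p.1 p.2) (0, 0) := by
  have ezx : ∀ x y, zx x y = k * x + a / 2 * x ^ 2 + b / 2 * y ^ 2 := by
    intro x y
    rw [hzx]
    simp only [hz]
    have h := (((((hasDerivAt_id x).pow 2).add_const (y ^ 2)).const_mul (k / 2)).add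
      (((hasDerivAt_id x).pow 3).const_mul (a / 6))).add
      (((hasDerivAt_id x).const_mul (b / 2)).mul_const (y ^ 2)) |>.add_const (c / 6 * y ^ 3)
    refine (HasDerivAt.deriv (h.congr_deriv ?_))
    simp; ring
  have ezy : ∀ x y, zy x y = k * y + b * x * y + c / 2 * y ^ 2 := by
    intro x y
    rw [hzy]
    simp only [hz]
    have h := (((((hasDerivAt_id y).pow 2).const_add (x ^ 2)).const_mul (k / 2)).add_const
      (a / 6 * x ^ 3)).add
      (((hasDerivAt_id y).pow 2).const_mul (b / 2 * x)) |>.add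
      (((hasDerivAt_id y).pow 3).const_mul (c / 6))
    refine (HasDerivAt.deriv (h.congr_deriv ?_))
    simp; ring
  have ezxx : ∀ x y, zxx x y = k + a * x := by
    intro x y
    rw [hzxx]
    simp only [ezx]
    have h := (((hasDerivAt_id x).const_mul k).add
      (((hasDerivAt_id x).pow 2).const_mul (a / 2))).add_const (b / 2 * y ^ 2)
    refine (HasDerivAt.deriv (h.congr_deriv ?_))
    simp; ring
  have ezxy : ∀ x y, zxy x y = b * y := by
    intro x y
    rw [hzxy]
    simp only [ezx]
    have h := (((hasDerivAt_id y).pow 2).const_mul (b / 2)).const_add (k * x + a / 2 * x ^ 2)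
    refine (HasDerivAt.deriv (h.congr_deriv ?_))
    simp; ring
  have ezyy : ∀ x y, zyy x y = k + b * x + c * y := by
    intro x y
    rw [hzyy]
    simp only [ezy]
    have h := (((hasDerivAt_id y).const_mul k).add
      ((hasDerivAt_id y).const_mul (b * x))).add
      (((hasDerivAt_id y).pow 2).const_mul (c / 2))
    refine (HasDerivAt.deriv (h.congr_deriv ?_))
    simp; ring
  have hH0 : Hm 0 0 = k := by
    rw [hHm]; simp [ezx, ezy, ezxx, ezxy, ezyy]
  have hK0 : Kg 0 0 = k ^ 2 := by
    rw [hKg]; simp [ezx, ezy, ezxx, ezxy, ezyy]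
    try ring
  refine ⟨by rw [hH0, hK0]; field_simp, hH0, ?_⟩
  let X := ContinuousLinearMap.fst ℝ ℝ ℝ
  let Y := ContinuousLinearMap.snd ℝ ℝ ℝ
  have dX : HasFDerivAt (fun p : ℝ × ℝ => p.1) X (0, 0) := hasFDerivAt_fst
  have dY : HasFDerivAt (fun p : ℝ × ℝ => p.2) Y (0, 0) := hasFDerivAt_snd
  have d1 : HasFDerivAt (fun p : ℝ × ℝ => zx p.1 p.2) (k • X) (0, 0) := by
    simp only [ezx]
    refine (((dX.const_mul k).add ((dX.pow 2).const_mul (a / 2))).add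
      ((dY.pow 2).const_mul (b / 2))).congr_fderiv ?_
    ext <;> simp
  have d2 : HasFDerivAt (fun p : ℝ × ℝ => zy p.1 p.2) (k • Y) (0, 0) := by
    simp only [ezy]
    refine (((dY.const_mul k).add ((dX.const_mul b).mul dY)).add
      ((dY.pow 2).const_mul (c / 2))).congr_fderiv ?_
    ext <;> simp
  have d3 : HasFDerivAt (fun p : ℝ × ℝ => zxx p.1 p.2) (a • X) (0, 0) := by
    simp only [ezxx]
    exact (dX.const_mul a).const_add k
  have d4 : HasFDerivAt (fun p : ℝ × ℝ => zxy p.1 p.2) (b • Y) (0, 0) := by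
    simp only [ezxy]
    exact dY.const_mul b
  have d5 : HasFDerivAt (fun p : ℝ × ℝ => zyy p.1 p.2) (b • X + c • Y) (0, 0) := by
    simp only [ezyy]
    exact ((dX.const_mul b).const_add k).add (dY.const_mul c)
  have z1 : zx 0 0 = 0 := by simp [ezx]
  have z2 : zy 0 0 = 0 := by simp [ezy]
  have z3 : zxx 0 0 = k := by simp [ezxx]
  have z4 : zxy 0 0 = 0 := by simp [ezxy]
  have z5 : zyy 0 0 = k := by simp [ezyy]
  have dw : HasFDerivAt (fun p : ℝ × ℝ => 1 + zx p.1 p.2 ^ 2 + zy p.1 p.2 ^ 2)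
      (0 : ℝ × ℝ →L[ℝ] ℝ) (0, 0) := by
    refine (((d1.pow 2).const_add 1).add (d2.pow 2)).congr_fderiv ?_
    ext <;> simp [z1, z2]
  have dH : HasFDerivAt (fun p : ℝ × ℝ => Hm p.1 p.2)
      ((1 / 2 : ℝ) • (a • X + b • X + c • Y)) (0, 0) := by
    simp only [hHm]
    have hr := (dw.rpow_const (p := (3 : ℝ) / 2) (Or.inl (by simp [z1, z2]))).const_mul 2
    have hn := ((((d2.pow 2).const_add 1).mul d3).sub
      (((d1.const_mul 2).mul d2).mul d4)).add (((d1.pow 2).const_add 1).mul d5)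
    refine (hasFDerivAt_div_aux hn hr (by simp [z1, z2])).congr_fderiv ?_
    ext <;> simp [z1, z2, z3, z4, z5, X, Y] <;> ring
  have dK : HasFDerivAt (fun p : ℝ × ℝ => Kg p.1 p.2)
      (k • (a • X + b • X + c • Y)) (0, 0) := by
    simp only [hKg]
    refine (hasFDerivAt_div_aux ((d3.mul d5).sub (d4.pow 2)) (dw.pow 2) (by simp [z1, z2])).congr_fderiv ?_
    ext <;> simp [z1, z2, z3, z4, z5, X, Y] <;> ring
  rw [dH.fderiv]
  refine HasFDerivAt.fderiv ((hasFDerivAt_div_aux dK dH (by simpa [hH0] using hk)).congr_fderiv ?_)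
  ext <;> simp [hH0, hK0, X, Y] <;> field_simp <;> ring
end

section
/- Let k, a, b, c ∈ ℝ with k ≠ 0 and let z(x,y) = (k/2)(x² + y²) + (a/6)x³ + (b/2)x y² + (c/6)y³. With E = 1 + z_x², F = z_x·z_y, G = 1 + z_y², W = √(1 + z_x² + z_y²), e = z_xx/W, f = z_xy/W, g = z_yy/W, and K, H the Gaussian and mean curvatures of the graph of z, define P₂ = g − (K/H)·G, P₁ = f − (K/H)·F, and P₀ = e − (K/H)·E (the coefficients of the harmonic mean curvature differential equation P₂ dy² + 2P₁ dx dy + P₀ dx² = 0). Then P₂(0,0) = P₁(0,0) = P₀(0,0) = 0, and the gradients at (0,0) are ∇P₂(0,0) = ((b − a)/2, c/2), ∇P₁(0,0) = (0, b), and ∇P₀(0,0) = ((a − b)/2, −c/2). -/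
theorem aux_curve (k pd qd rd sd ud : ℝ) (hk : k ≠ 0)
    (p q r s u E F G W e f g K H : ℝ → ℝ)
    (hp : HasDerivAt p pd 0) (hq : HasDerivAt q qd 0) (hr : HasDerivAt r rd 0)
    (hs : HasDerivAt s sd 0) (hu : HasDerivAt u ud 0)
    (p0 : p 0 = 0) (q0 : q 0 = 0) (r0 : r 0 = k) (s0 : s 0 = 0) (u0 : u 0 = k)
    (hE : ∀ t, E t = 1 + p t ^ 2) (hF : ∀ t, F t = p t * q t) (hG : ∀ t, G t = 1 + q t ^ 2)
    (hW : ∀ t, W t = Real.sqrt (1 + p t ^ 2 + q t ^ 2))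
    (he : ∀ t, e t = r t / W t) (hf : ∀ t, f t = s t / W t) (hg : ∀ t, g t = u t / W t)
    (hK : ∀ t, K t = (e t * g t - f t ^ 2) / (E t * G t - F t ^ 2))
    (hH : ∀ t, H t = (e t * G t - 2 * f t * F t + g t * E t) / (2 * (E t * G t - F t ^ 2))) :
    (g 0 - K 0 / H 0 * G 0 = 0 ∧ f 0 - K 0 / H 0 * F 0 = 0 ∧ e 0 - K 0 / H 0 * E 0 = 0) ∧
    HasDerivAt (fun t => g t - K t / H t * G t) ((ud - rd) / 2) 0 ∧
    HasDerivAt (fun t => f t - K t / H t * F t) sd 0 ∧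
    HasDerivAt (fun t => e t - K t / H t * E t) ((rd - ud) / 2) 0 := by
  have E0 : E 0 = 1 := by simp [hE, p0]
  have F0 : F 0 = 0 := by simp [hF, p0]
  have G0 : G 0 = 1 := by simp [hG, q0]
  have W0 : W 0 = 1 := by simp [hW, p0, q0]
  have e0 : e 0 = k := by simp [he, r0, W0]
  have f0 : f 0 = 0 := by simp [hf, s0]
  have g0 : g 0 = k := by simp [hg, u0, W0]
  have K0 : K 0 = k ^ 2 := by rw [hK, e0, f0, g0, E0, F0, G0]; ring
  have H0 : H 0 = k := by rw [hH, e0, f0, g0, E0, F0, G0]; ring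
  have dE : HasDerivAt E 0 0 := by
    rw [funext hE]
    exact ((hp.fun_pow 2).const_add 1).congr_deriv (by simp [p0])
  have dG : HasDerivAt G 0 0 := by
    rw [funext hG]
    exact ((hq.fun_pow 2).const_add 1).congr_deriv (by simp [q0])
  have dF : HasDerivAt F 0 0 := by
    rw [funext hF]
    exact (hp.fun_mul hq).congr_deriv (by simp [p0, q0])
  have dW : HasDerivAt W 0 0 := by
    rw [funext hW]
    exact ((((hp.fun_pow 2).const_add 1).fun_add (hq.fun_pow 2)).sqrt
      (by simp [p0, q0])).congr_deriv (by simp [p0, q0])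
  have W1 : W 0 ≠ 0 := by simp [W0]
  have de : HasDerivAt e rd 0 := by
    rw [funext he]
    exact (hr.fun_div dW W1).congr_deriv (by simp [W0])
  have df : HasDerivAt f sd 0 := by
    rw [funext hf]
    exact (hs.fun_div dW W1).congr_deriv (by simp [W0])
  have dg : HasDerivAt g ud 0 := by
    rw [funext hg]
    exact (hu.fun_div dW W1).congr_deriv (by simp [W0])
  have dD := (dE.fun_mul dG).fun_sub (dF.fun_pow 2)
  have dK : HasDerivAt K (k * (rd + ud)) 0 := by
    rw [funext hK]
    refine (((de.fun_mul dg).fun_sub (df.fun_pow 2)).fun_div dD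
      (by simp [E0, F0, G0])).congr_deriv ?_
    simp [E0, F0, G0, e0, f0, g0]; ring
  have dH : HasDerivAt H ((rd + ud) / 2) 0 := by
    rw [funext hH]
    refine ((((de.fun_mul dG).fun_sub ((df.const_mul 2).fun_mul dF)).fun_add
      (dg.fun_mul dE)).fun_div (dD.const_mul 2) (by simp [E0, F0, G0])).congr_deriv ?_
    simp [E0, F0, G0, e0, f0, g0]; ring
  have dQ : HasDerivAt (fun t => K t / H t) ((rd + ud) / 2) 0 := by
    refine (dK.fun_div dH (by rwa [H0])).congr_deriv ?_
    rw [K0, H0]; field_simp; ring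
  have Q0 : K 0 / H 0 = k := by rw [K0, H0]; field_simp
  refine ⟨⟨?_, ?_, ?_⟩, ?_, ?_, ?_⟩
  · rw [Q0, g0, G0]; ring
  · rw [Q0, f0, F0]; ring
  · rw [Q0, e0, E0]; ring
  · refine (dg.fun_sub (dQ.fun_mul dG)).congr_deriv ?_
    rw [G0]; ring
  · refine (df.fun_sub (dQ.fun_mul dF)).congr_deriv ?_
    rw [F0]; ring
  · refine (de.fun_sub (dQ.fun_mul dE)).congr_deriv ?_
    rw [E0]; ring

theorem aux_poly (A B C D x : ℝ) :
    HasDerivAt (fun t : ℝ => A + B * t + C * t ^ 2 + D * t ^ 3)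
      (B + 2 * C * x + 3 * D * x ^ 2) x := by
  refine (((((hasDerivAt_id' x).const_mul B).const_add A).fun_add
    ((hasDerivAt_pow 2 x).const_mul C)).fun_add
    ((hasDerivAt_pow 3 x).const_mul D)).congr_deriv ?_
  norm_num; ring

theorem aux_polyfun (φ : ℝ → ℝ) (A B C D x : ℝ)
    (h : ∀ t, φ t = A + B * t + C * t ^ 2 + D * t ^ 3) :
    HasDerivAt φ (B + 2 * C * x + 3 * D * x ^ 2) x := by
  rw [funext h]; exact aux_poly A B C D x

theorem harmonic_mean_curvature_equation_coefficients_at_umbilic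
    (k a b c : ℝ) (hk : k ≠ 0)
    (z zx zy zxx zxy zyy EE FF GG W se sf sg Kg Hm P₂ P₁ P₀ : ℝ → ℝ → ℝ)
    (hz : ∀ x y, z x y = k / 2 * (x ^ 2 + y ^ 2) + a / 6 * x ^ 3 + b / 2 * x * y ^ 2
      + c / 6 * y ^ 3)
    (hzx : ∀ x y, zx x y = deriv (fun t => z t y) x)
    (hzy : ∀ x y, zy x y = deriv (fun t => z x t) y)
    (hzxx : ∀ x y, zxx x y = deriv (fun t => zx t y) x)
    (hzxy : ∀ x y, zxy x y = deriv (fun t => zx x t) y)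
    (hzyy : ∀ x y, zyy x y = deriv (fun t => zy x t) y)
    (hEE : ∀ x y, EE x y = 1 + zx x y ^ 2)
    (hFF : ∀ x y, FF x y = zx x y * zy x y)
    (hGG : ∀ x y, GG x y = 1 + zy x y ^ 2)
    (hW : ∀ x y, W x y = Real.sqrt (1 + zx x y ^ 2 + zy x y ^ 2))
    (hse : ∀ x y, se x y = zxx x y / W x y)
    (hsf : ∀ x y, sf x y = zxy x y / W x y)
    (hsg : ∀ x y, sg x y = zyy x y / W x y)
    (hKg : ∀ x y, Kg x y = (se x y * sg x y - sf x y ^ 2) /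
      (EE x y * GG x y - FF x y ^ 2))
    (hHm : ∀ x y, Hm x y = (se x y * GG x y - 2 * sf x y * FF x y + sg x y * EE x y) /
      (2 * (EE x y * GG x y - FF x y ^ 2)))
    (hP₂ : ∀ x y, P₂ x y = sg x y - (Kg x y / Hm x y) * GG x y)
    (hP₁ : ∀ x y, P₁ x y = sf x y - (Kg x y / Hm x y) * FF x y)
    (hP₀ : ∀ x y, P₀ x y = se x y - (Kg x y / Hm x y) * EE x y) :
    P₂ 0 0 = 0 ∧ P₁ 0 0 = 0 ∧ P₀ 0 0 = 0 ∧
      (deriv (fun t => P₂ t 0) 0, deriv (fun t => P₂ 0 t) 0) = ((b - a) / 2, c / 2) ∧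
      (deriv (fun t => P₁ t 0) 0, deriv (fun t => P₁ 0 t) 0) = (0, b) ∧
      (deriv (fun t => P₀ t 0) 0, deriv (fun t => P₀ 0 t) 0) = ((a - b) / 2, -c / 2) := by
  have zx_eq : ∀ x y, zx x y = k * x + a / 2 * x ^ 2 + b / 2 * y ^ 2 := fun x y => by
    rw [hzx, (aux_polyfun (fun t => z t y) (k / 2 * y ^ 2 + c / 6 * y ^ 3) (b / 2 * y ^ 2) (k / 2)
      (a / 6) x (fun t => by simp only [hz]; ring)).deriv]; ring
  have zy_eq : ∀ x y, zy x y = k * y + b * x * y + c / 2 * y ^ 2 := fun x y => by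
    rw [hzy, (aux_polyfun (fun t => z x t) (k / 2 * x ^ 2 + a / 6 * x ^ 3) 0 (k / 2 + b / 2 * x)
      (c / 6) y (fun t => by simp only [hz]; ring)).deriv]; ring
  have zxx_eq : ∀ x y, zxx x y = k + a * x := fun x y => by
    rw [hzxx, (aux_polyfun (fun t => zx t y) (b / 2 * y ^ 2) k (a / 2) 0 x
      (fun t => by simp only [zx_eq]; ring)).deriv]; ring
  have zxy_eq : ∀ x y, zxy x y = b * y := fun x y => by
    rw [hzxy, (aux_polyfun (fun t => zx x t) (k * x + a / 2 * x ^ 2) 0 (b / 2) 0 y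
      (fun t => by simp only [zx_eq]; ring)).deriv]; ring
  have zyy_eq : ∀ x y, zyy x y = k + b * x + c * y := fun x y => by
    rw [hzyy, (aux_polyfun (fun t => zy x t) 0 (k + b * x) (c / 2) 0 y
      (fun t => by simp only [zy_eq]; ring)).deriv]; ring
  obtain ⟨⟨h2, h1, h0⟩, x2, x1, x0⟩ := aux_curve k _ _ _ _ _ hk
    (fun t => zx t 0) (fun t => zy t 0) (fun t => zxx t 0) (fun t => zxy t 0) (fun t => zyy t 0)
    (fun t => EE t 0) (fun t => FF t 0) (fun t => GG t 0) (fun t => W t 0)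
    (fun t => se t 0) (fun t => sf t 0) (fun t => sg t 0) (fun t => Kg t 0) (fun t => Hm t 0)
    (aux_polyfun _ 0 k (a / 2) 0 0 (fun t => by simp only [zx_eq]; ring))
    (aux_polyfun _ 0 0 0 0 0 (fun t => by simp only [zy_eq]; ring))
    (aux_polyfun _ k a 0 0 0 (fun t => by simp only [zxx_eq]; ring))
    (aux_polyfun _ 0 0 0 0 0 (fun t => by simp only [zxy_eq]; ring))
    (aux_polyfun _ k b 0 0 0 (fun t => by simp only [zyy_eq]; ring))
    (by simp [zx_eq]) (by simp [zy_eq]) (by simp [zxx_eq]) (by simp [zxy_eq]) (by simp [zyy_eq])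
    (fun t => hEE t 0) (fun t => hFF t 0) (fun t => hGG t 0) (fun t => hW t 0)
    (fun t => hse t 0) (fun t => hsf t 0) (fun t => hsg t 0) (fun t => hKg t 0) (fun t => hHm t 0)
  obtain ⟨-, y2, y1, y0⟩ := aux_curve k _ _ _ _ _ hk
    (zx 0) (zy 0) (zxx 0) (zxy 0) (zyy 0) (EE 0) (FF 0) (GG 0) (W 0)
    (se 0) (sf 0) (sg 0) (Kg 0) (Hm 0)
    (aux_polyfun _ 0 0 (b / 2) 0 0 (fun t => by simp only [zx_eq]; ring))
    (aux_polyfun _ 0 k (c / 2) 0 0 (fun t => by simp only [zy_eq]; ring))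
    (aux_polyfun _ k 0 0 0 0 (fun t => by simp only [zxx_eq]; ring))
    (aux_polyfun _ 0 b 0 0 0 (fun t => by simp only [zxy_eq]; ring))
    (aux_polyfun _ k c 0 0 0 (fun t => by simp only [zyy_eq]; ring))
    (by simp [zx_eq]) (by simp [zy_eq]) (by simp [zxx_eq]) (by simp [zxy_eq]) (by simp [zyy_eq])
    (hEE 0) (hFF 0) (hGG 0) (hW 0) (hse 0) (hsf 0) (hsg 0) (hKg 0) (hHm 0)
  simp only [← hP₂, ← hP₁, ← hP₀] at h2 h1 h0 x2 x1 x0 y2 y1 y0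
  refine ⟨h2, h1, h0, Prod.ext ?_ ?_, Prod.ext ?_ ?_, Prod.ext ?_ ?_⟩
  · exact x2.deriv.trans (by ring)
  · exact y2.deriv.trans (by ring)
  · exact x1.deriv.trans (by ring)
  · exact y1.deriv.trans (by ring)
  · exact x0.deriv.trans (by ring)
  · exact y0.deriv.trans (by ring)
end

section
/- Let k, a, b, c, d, A, B, C, D, E ∈ ℝ and let z(x,y) = (k/2)y² + (a/6)x³ + (d/2)x²y + (b/2)x y² + (c/6)y³ + (A/24)x⁴ + (B/6)x³y + (C/4)x²y² + (D/6)x y³ + (E/24)y⁴. Then the Gaussian curvature K of the graph of z satisfies: K(0,0) = 0, ∂K/∂x(0,0) = k·a, ∂K/∂y(0,0) = k·d, ∂²K/∂x²(0,0) = A·k + 2ab − 2d², ∂²K/∂x∂y(0,0) = B·k + ac − bd, and ∂²K/∂y²(0,0) = C·k + 2cd − 2b². -/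
theorem hasDerivAt_quartic (c0 c1 c2 c3 c4 x : ℝ) (f : ℝ → ℝ) (f' : ℝ)
    (hf : ∀ t, f t = c0 + c1 * t + c2 * t ^ 2 + c3 * t ^ 3 + c4 * t ^ 4)
    (hf' : f' = c1 + 2 * c2 * x + 3 * c3 * x ^ 2 + 4 * c4 * x ^ 3) :
    HasDerivAt f f' x := by
  have e : f = fun t => c0 + c1 * t + c2 * t ^ 2 + c3 * t ^ 3 + c4 * t ^ 4 := funext hf
  rw [e]
  have h := (((((hasDerivAt_id' x).const_mul c1).const_add c0).add
    (((hasDerivAt_id' x).pow 2).const_mul c2)).add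
    (((hasDerivAt_id' x).pow 3).const_mul c3)).add
    (((hasDerivAt_id' x).pow 4).const_mul c4)
  refine HasDerivAt.congr_deriv h ?_
  rw [hf']; norm_num; ring

/-- First derivative of the curvature expression along a line. -/
theorem hasDerivAt_curv {r s m p q : ℝ → ℝ} {r1 s1 m1 p1 q1 x : ℝ}
    (hr : HasDerivAt r r1 x) (hs : HasDerivAt s s1 x) (hm : HasDerivAt m m1 x)
    (hp : HasDerivAt p p1 x) (hq : HasDerivAt q q1 x) :
    HasDerivAt (fun t => (r t * s t - m t ^ 2) / (1 + p t ^ 2 + q t ^ 2) ^ 2)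
      (((r1 * s x + r x * s1 - 2 * m x * m1) * (1 + p x ^ 2 + q x ^ 2)
        - (r x * s x - m x ^ 2) * (4 * (p x * p1 + q x * q1)))
        / (1 + p x ^ 2 + q x ^ 2) ^ 3) x := by
  have hW : (1 + p x ^ 2 + q x ^ 2) ≠ 0 := by positivity
  have h := ((hr.mul hs).sub (hm.pow 2)).div ((((hp.pow 2).const_add 1).add (hq.pow 2)).pow 2)
    (pow_ne_zero 2 hW)
  refine HasDerivAt.congr_deriv h ?_
  simp only [Pi.mul_apply, Pi.sub_apply, Pi.pow_apply, Pi.add_apply]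
  field_simp
  norm_num
  ring

/-- Derivative at `0` of the first derivative of the curvature expression. -/
theorem deriv_curv' {r s m p q r1 s1 m1 p1 q1 : ℝ → ℝ}
    {r' s' m' p' q' r1' s1' m1' p1' q1' : ℝ}
    (hr : HasDerivAt r r' 0) (hs : HasDerivAt s s' 0) (hm : HasDerivAt m m' 0)
    (hp : HasDerivAt p p' 0) (hq : HasDerivAt q q' 0)
    (hr1 : HasDerivAt r1 r1' 0) (hs1 : HasDerivAt s1 s1' 0) (hm1 : HasDerivAt m1 m1' 0)
    (hp1 : HasDerivAt p1 p1' 0) (hq1 : HasDerivAt q1 q1' 0)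
    (r0 : r 0 = 0) (m0 : m 0 = 0) (p0 : p 0 = 0) (q0 : q 0 = 0) :
    deriv (fun t => ((r1 t * s t + r t * s1 t - 2 * m t * m1 t) * (1 + p t ^ 2 + q t ^ 2)
        - (r t * s t - m t ^ 2) * (4 * (p t * p1 t + q t * q1 t)))
        / (1 + p t ^ 2 + q t ^ 2) ^ 3) 0
      = r1' * s 0 + r1 0 * s' + r' * s1 0 - 2 * m' * m1 0 := by
  have hW : (1 + p 0 ^ 2 + q 0 ^ 2) ≠ 0 := by positivity
  have hw := ((hp.pow 2).const_add 1).add (hq.pow 2)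
  have h := ((((((hr1.mul hs).add (hr.mul hs1)).sub ((hm.const_mul 2).mul hm1)).mul hw).sub
    (((hr.mul hs).sub (hm.pow 2)).mul (((hp.mul hp1).add (hq.mul hq1)).const_mul 4)))).div
    (hw.pow 3) (pow_ne_zero 3 hW)
  refine (HasDerivAt.congr_deriv h ?_).deriv
  simp [r0, m0, p0, q0]

theorem gaussian_curvature_two_jet_at_parabolic_point
    (k a b c d A B C D E : ℝ)
    (z zx zy zxx zxy zyy Kg Kx Ky : ℝ → ℝ → ℝ)
    (hz : ∀ x y, z x y = k / 2 * y ^ 2 + a / 6 * x ^ 3 + d / 2 * x ^ 2 * y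
      + b / 2 * x * y ^ 2 + c / 6 * y ^ 3 + A / 24 * x ^ 4 + B / 6 * x ^ 3 * y
      + C / 4 * x ^ 2 * y ^ 2 + D / 6 * x * y ^ 3 + E / 24 * y ^ 4)
    (hzx : ∀ x y, zx x y = deriv (fun t => z t y) x)
    (hzy : ∀ x y, zy x y = deriv (fun t => z x t) y)
    (hzxx : ∀ x y, zxx x y = deriv (fun t => zx t y) x)
    (hzxy : ∀ x y, zxy x y = deriv (fun t => zx x t) y)
    (hzyy : ∀ x y, zyy x y = deriv (fun t => zy x t) y)
    (hKg : ∀ x y, Kg x y =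
      (zxx x y * zyy x y - zxy x y ^ 2) / (1 + zx x y ^ 2 + zy x y ^ 2) ^ 2)
    (hKx : ∀ x y, Kx x y = deriv (fun t => Kg t y) x)
    (hKy : ∀ x y, Ky x y = deriv (fun t => Kg x t) y) :
    Kg 0 0 = 0 ∧ Kx 0 0 = k * a ∧ Ky 0 0 = k * d ∧
      deriv (fun t => Kx t 0) 0 = A * k + 2 * a * b - 2 * d ^ 2 ∧
      deriv (fun t => Kx 0 t) 0 = B * k + a * c - b * d ∧
      deriv (fun t => Ky 0 t) 0 = C * k + 2 * c * d - 2 * b ^ 2 := by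
  have ezx : ∀ x y, zx x y = a / 2 * x ^ 2 + d * x * y + b / 2 * y ^ 2 + A / 6 * x ^ 3 + B / 2 * x ^ 2 * y + C / 2 * x * y ^ 2 + D / 6 * y ^ 3 := by
    intro x y
    rw [hzx]
    refine HasDerivAt.deriv ?_
    exact hasDerivAt_quartic (k / 2 * y ^ 2 + c / 6 * y ^ 3 + E / 24 * y ^ 4) (b / 2 * y ^ 2 + D / 6 * y ^ 3) (d / 2 * y + C / 4 * y ^ 2) (a / 6 + B / 6 * y) (A / 24) x _ _ (fun t => by simp only [hz]; ring) (by ring)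
  have ezy : ∀ x y, zy x y = k * y + d / 2 * x ^ 2 + b * x * y + c / 2 * y ^ 2 + B / 6 * x ^ 3 + C / 2 * x ^ 2 * y + D / 2 * x * y ^ 2 + E / 6 * y ^ 3 := by
    intro x y
    rw [hzy]
    refine HasDerivAt.deriv ?_
    exact hasDerivAt_quartic (a / 6 * x ^ 3 + A / 24 * x ^ 4) (d / 2 * x ^ 2 + B / 6 * x ^ 3) (k / 2 + b / 2 * x + C / 4 * x ^ 2) (c / 6 + D / 6 * x) (E / 24) y _ _ (fun t => by simp only [hz]; ring) (by ring)
  have ezxx : ∀ x y, zxx x y = a * x + d * y + A / 2 * x ^ 2 + B * x * y + C / 2 * y ^ 2 := by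
    intro x y
    rw [hzxx]
    refine HasDerivAt.deriv ?_
    exact hasDerivAt_quartic (b / 2 * y ^ 2 + D / 6 * y ^ 3) (d * y + C / 2 * y ^ 2) (a / 2 + B / 2 * y) (A / 6) (0) x _ _ (fun t => by simp only [ezx]; ring) (by ring)
  have ezxy : ∀ x y, zxy x y = d * x + b * y + B / 2 * x ^ 2 + C * x * y + D / 2 * y ^ 2 := by
    intro x y
    rw [hzxy]
    refine HasDerivAt.deriv ?_
    exact hasDerivAt_quartic (a / 2 * x ^ 2 + A / 6 * x ^ 3) (d * x + B / 2 * x ^ 2) (b / 2 + C / 2 * x) (D / 6) (0) y _ _ (fun t => by simp only [ezx]; ring) (by ring)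
  have ezyy : ∀ x y, zyy x y = k + b * x + c * y + C / 2 * x ^ 2 + D * x * y + E / 2 * y ^ 2 := by
    intro x y
    rw [hzyy]
    refine HasDerivAt.deriv ?_
    exact hasDerivAt_quartic (d / 2 * x ^ 2 + B / 6 * x ^ 3) (k + b * x + C / 2 * x ^ 2) (c / 2 + D / 2 * x) (E / 6) (0) y _ _ (fun t => by simp only [ezy]; ring) (by ring)
  have dzx_x : ∀ x y, HasDerivAt (fun t => zx t y) (zxx x y) x := by
    intro x y
    rw [ezxx]
    exact hasDerivAt_quartic (b / 2 * y ^ 2 + D / 6 * y ^ 3) (d * y + C / 2 * y ^ 2) (a / 2 + B / 2 * y) (A / 6) (0) x _ _ (fun t => by simp only [ezx]; ring) (by ring)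
  have dzx_y : ∀ x y, HasDerivAt (fun t => zx x t) (zxy x y) y := by
    intro x y
    rw [ezxy]
    exact hasDerivAt_quartic (a / 2 * x ^ 2 + A / 6 * x ^ 3) (d * x + B / 2 * x ^ 2) (b / 2 + C / 2 * x) (D / 6) (0) y _ _ (fun t => by simp only [ezx]; ring) (by ring)
  have dzy_x : ∀ x y, HasDerivAt (fun t => zy t y) (zxy x y) x := by
    intro x y
    rw [ezxy]
    exact hasDerivAt_quartic (k * y + c / 2 * y ^ 2 + E / 6 * y ^ 3) (b * y + D / 2 * y ^ 2) (d / 2 + C / 2 * y) (B / 6) (0) x _ _ (fun t => by simp only [ezy]; ring) (by ring)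
  have dzy_y : ∀ x y, HasDerivAt (fun t => zy x t) (zyy x y) y := by
    intro x y
    rw [ezyy]
    exact hasDerivAt_quartic (d / 2 * x ^ 2 + B / 6 * x ^ 3) (k + b * x + C / 2 * x ^ 2) (c / 2 + D / 2 * x) (E / 6) (0) y _ _ (fun t => by simp only [ezy]; ring) (by ring)
  have dzxx_x : ∀ x y, HasDerivAt (fun t => zxx t y) (a + A * x + B * y) x := by
    intro x y
    exact hasDerivAt_quartic (d * y + C / 2 * y ^ 2) (a + B * y) (A / 2) (0) (0) x _ _ (fun t => by simp only [ezxx]; ring) (by ring)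
  have dzxx_y : ∀ x y, HasDerivAt (fun t => zxx x t) (d + B * x + C * y) y := by
    intro x y
    exact hasDerivAt_quartic (a * x + A / 2 * x ^ 2) (d + B * x) (C / 2) (0) (0) y _ _ (fun t => by simp only [ezxx]; ring) (by ring)
  have dzxy_x : ∀ x y, HasDerivAt (fun t => zxy t y) (d + B * x + C * y) x := by
    intro x y
    exact hasDerivAt_quartic (b * y + D / 2 * y ^ 2) (d + C * y) (B / 2) (0) (0) x _ _ (fun t => by simp only [ezxy]; ring) (by ring)
  have dzxy_y : ∀ x y, HasDerivAt (fun t => zxy x t) (b + C * x + D * y) y := by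
    intro x y
    exact hasDerivAt_quartic (d * x + B / 2 * x ^ 2) (b + C * x) (D / 2) (0) (0) y _ _ (fun t => by simp only [ezxy]; ring) (by ring)
  have dzyy_x : ∀ x y, HasDerivAt (fun t => zyy t y) (b + C * x + D * y) x := by
    intro x y
    exact hasDerivAt_quartic (k + c * y + E / 2 * y ^ 2) (b + D * y) (C / 2) (0) (0) x _ _ (fun t => by simp only [ezyy]; ring) (by ring)
  have dzyy_y : ∀ x y, HasDerivAt (fun t => zyy x t) (c + D * x + E * y) y := by
    intro x y
    exact hasDerivAt_quartic (k + b * x + C / 2 * x ^ 2) (c + D * x) (E / 2) (0) (0) y _ _ (fun t => by simp only [ezyy]; ring) (by ring)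
  have eKx : ∀ x y, Kx x y = (((a + A * x + B * y) * zyy x y + zxx x y * (b + C * x + D * y) - 2 * zxy x y * (d + B * x + C * y)) * (1 + zx x y ^ 2 + zy x y ^ 2) - (zxx x y * zyy x y - zxy x y ^ 2) * (4 * (zx x y * zxx x y + zy x y * zxy x y))) / (1 + zx x y ^ 2 + zy x y ^ 2) ^ 3 := by
    intro x y
    rw [hKx]
    simp only [hKg]
    exact (hasDerivAt_curv (dzxx_x x y) (dzyy_x x y) (dzxy_x x y) (dzx_x x y) (dzy_x x y)).deriv
  have eKy : ∀ x y, Ky x y = (((d + B * x + C * y) * zyy x y + zxx x y * (c + D * x + E * y) - 2 * zxy x y * (b + C * x + D * y)) * (1 + zx x y ^ 2 + zy x y ^ 2) - (zxx x y * zyy x y - zxy x y ^ 2) * (4 * (zx x y * zxy x y + zy x y * zyy x y))) / (1 + zx x y ^ 2 + zy x y ^ 2) ^ 3 := by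
    intro x y
    rw [hKy]
    simp only [hKg]
    exact (hasDerivAt_curv (dzxx_y x y) (dzyy_y x y) (dzxy_y x y) (dzx_y x y) (dzy_y x y)).deriv
  have lin : ∀ u v w : ℝ, HasDerivAt (fun t => u + v * t + w * 0) v 0 := fun u v w =>
    hasDerivAt_quartic u v 0 0 0 0 _ _ (fun t => by ring) (by ring)
  have lin' : ∀ u v w : ℝ, HasDerivAt (fun t => u + v * 0 + w * t) w 0 := fun u v w =>
    hasDerivAt_quartic u w 0 0 0 0 _ _ (fun t => by ring) (by ring)
  have zx0 : zx 0 0 = 0 := by rw [ezx]; ring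
  have zy0 : zy 0 0 = 0 := by rw [ezy]; ring
  have zxx0 : zxx 0 0 = 0 := by rw [ezxx]; ring
  have zxy0 : zxy 0 0 = 0 := by rw [ezxy]; ring
  have zyy0 : zyy 0 0 = k := by rw [ezyy]; ring
  refine ⟨?_, ?_, ?_, ?_, ?_, ?_⟩
  · simp [hKg, zxx0, zxy0]
  · simp [eKx, zx0, zy0, zxx0, zxy0, zyy0, mul_comm]
  · simp [eKy, zx0, zy0, zxx0, zxy0, zyy0, mul_comm]
  · simp only [eKx]
    refine (deriv_curv' (dzxx_x 0 0) (dzyy_x 0 0) (dzxy_x 0 0) (dzx_x 0 0) (dzy_x 0 0)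
      (lin _ _ _) (lin _ _ _) (lin _ _ _) (dzxx_x 0 0) (dzxy_x 0 0) zxx0 zxy0 zx0 zy0).trans ?_
    rw [zyy0]; ring
  · simp only [eKx]
    refine (deriv_curv' (dzxx_y 0 0) (dzyy_y 0 0) (dzxy_y 0 0) (dzx_y 0 0) (dzy_y 0 0)
      (lin' _ _ _) (lin' _ _ _) (lin' _ _ _) (dzxx_y 0 0) (dzxy_y 0 0) zxx0 zxy0 zx0 zy0).trans ?_
    rw [zyy0]; ring
  · simp only [eKy]
    refine (deriv_curv' (dzxx_y 0 0) (dzyy_y 0 0) (dzxy_y 0 0) (dzx_y 0 0) (dzy_y 0 0)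
      (lin' _ _ _) (lin' _ _ _) (lin' _ _ _) (dzxy_y 0 0) (dzyy_y 0 0) zxx0 zxy0 zx0 zy0).trans ?_
    rw [zyy0]; ring
end

section
/- Let k, b, d, A, B ∈ ℝ and consider the 3×3 real matrix M = [[2kd, 2kb, 2k²], [0, 0, 0], [Ak − 4d², kB − 3bd, −kd]]. Then the characteristic polynomial of M is X·(X² − kd·X − 2k²·(Ak − 3d²)). In particular, 0 is an eigenvalue and the other two eigenvalues λ₁, λ₂ satisfy λ₁ + λ₂ = kd and λ₁·λ₂ = −2k²·(Ak − 3d²). -/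
open Polynomial

theorem charpoly_of_lie_cartan_linearization_harmonic
    (k b d A B : ℝ) (M : Matrix (Fin 3) (Fin 3) ℝ)
    (hM : M = !![2 * k * d, 2 * k * b, 2 * k ^ 2;
                 0, 0, 0;
                 A * k - 4 * d ^ 2, k * B - 3 * b * d, -(k * d)]) :
    M.charpoly = X * (X ^ 2 - C (k * d) * X - C (2 * k ^ 2 * (A * k - 3 * d ^ 2))) ∧
      M.charpoly.IsRoot 0 ∧
      ∀ l₁ l₂ : ℂ,
        (X ^ 2 - C ((k * d : ℝ) : ℂ) * X - C ((2 * k ^ 2 * (A * k - 3 * d ^ 2) : ℝ) : ℂ)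
          = (X - C l₁) * (X - C l₂)) →
        l₁ + l₂ = ((k * d : ℝ) : ℂ) ∧
        l₁ * l₂ = -((2 * k ^ 2 * (A * k - 3 * d ^ 2) : ℝ) : ℂ) := by
  have h : M.charpoly
      = X * (X ^ 2 - C (k * d) * X - C (2 * k ^ 2 * (A * k - 3 * d ^ 2))) := by
    subst hM
    rw [Matrix.charpoly, Matrix.det_fin_three]
    have c2 : (C 2 : ℝ[X]) = 2 := rfl
    have c3 : (C 3 : ℝ[X]) = 3 := rfl
    have c4 : (C 4 : ℝ[X]) = 4 := rfl
    simp [c2, c3, c4]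
    ring
  refine ⟨h, ?_, ?_⟩
  · rw [h]
    simp [Polynomial.IsRoot]
  · intro l₁ l₂ hl
    have h0 := congrArg (Polynomial.eval 0) hl
    have h1 := congrArg (Polynomial.eval 1) hl
    simp only [eval_sub, eval_mul, eval_pow, eval_X, eval_C] at h0 h1
    constructor
    · linear_combination h1 - h0
    · linear_combination -h0
end

section
/- Let k, d, A ∈ ℝ with k ≠ 0 and consider the quadratic polynomial q(X) = X² − kd·X − 2k²·(Ak − 3d²). Then: (i) if Ak − 3d² > 0, q has two distinct real roots λ₁, λ₂ with λ₁ < 0 < λ₂ (folded saddle); (ii) if Ak − 3d² < 0, d ≠ 0, and 8Ak − 23d² > 0, q has two distinct nonzero real roots with the same sign (folded node); (iii) if 8Ak − 23d² < 0, q has no real roots (folded focus). -/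
theorem folded_singularity_classification_harmonic
    (k d A : ℝ) (hk : k ≠ 0) (q : ℝ → ℝ)
    (hq : ∀ X : ℝ, q X = X ^ 2 - k * d * X - 2 * k ^ 2 * (A * k - 3 * d ^ 2)) :
    (0 < A * k - 3 * d ^ 2 →
      ∃ l₁ l₂ : ℝ, q l₁ = 0 ∧ q l₂ = 0 ∧ l₁ < 0 ∧ 0 < l₂) ∧
    (A * k - 3 * d ^ 2 < 0 → d ≠ 0 → 0 < 8 * A * k - 23 * d ^ 2 →
      ∃ l₁ l₂ : ℝ, q l₁ = 0 ∧ q l₂ = 0 ∧ l₁ ≠ l₂ ∧ 0 < l₁ * l₂) ∧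
    (8 * A * k - 23 * d ^ 2 < 0 → ∀ x : ℝ, q x ≠ 0) := by
  have hk2 : 0 < k ^ 2 := by positivity
  have root : 0 < 8 * A * k - 23 * d ^ 2 → ∃ s : ℝ, 0 < s ∧
      s ^ 2 = k ^ 2 * (8 * A * k - 23 * d ^ 2) := fun h =>
    ⟨√(k ^ 2 * (8 * A * k - 23 * d ^ 2)), Real.sqrt_pos.mpr (mul_pos hk2 h),
      Real.sq_sqrt (mul_pos hk2 h).le⟩
  refine ⟨fun h => ?_, fun h _ h8 => ?_, fun h x hx => ?_⟩
  · obtain ⟨s, hs, hs2⟩ := root (by nlinarith [sq_nonneg d])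
    have hp := mul_pos hk2 h
    have habs : |k * d| < s := abs_lt_of_sq_lt_sq (by nlinarith) hs.le
    obtain ⟨h1, h2⟩ := abs_lt.mp habs
    refine ⟨(k * d - s) / 2, (k * d + s) / 2, ?_, ?_, by linarith, by linarith⟩
    · rw [hq]; linear_combination hs2 / 4
    · rw [hq]; linear_combination hs2 / 4
  · obtain ⟨s, hs, hs2⟩ := root h8
    have hp := mul_pos hk2 (neg_pos.mpr h)
    refine ⟨(k * d - s) / 2, (k * d + s) / 2, ?_, ?_, fun e => by linarith, by nlinarith⟩
    · rw [hq]; linear_combination hs2 / 4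
    · rw [hq]; linear_combination hs2 / 4
  · rw [hq] at hx
    have hp := mul_pos hk2 (neg_pos.mpr h)
    nlinarith [sq_nonneg (2 * x - k * d)]
end

section
/- Let k, d, A ∈ ℝ and consider the quadratic polynomial r(X) = X² + d·X + 2·(Ak − 3d²). Then: (i) if Ak − 3d² < 0, r has two distinct real roots of opposite signs (asymptotic folded saddle); (ii) if Ak − 3d² > 0, d ≠ 0, and 25d² − 8Ak > 0, r has two distinct nonzero real roots with the same sign (asymptotic folded node); (iii) if 25d² − 8Ak < 0, r has no real roots (asymptotic folded focus). In particular, whenever Ak − 3d² ≠ 0, the asymptotic tangential singularity is a saddle exactly when the harmonic one (governed by root product −2k²(Ak − 3d²)) is a node or focus, and vice versa. -/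
theorem folded_singularity_classification_asymptotic
    (k d A : ℝ) (r : ℝ → ℝ)
    (hr : ∀ X : ℝ, r X = X ^ 2 + d * X + 2 * (A * k - 3 * d ^ 2)) :
    (A * k - 3 * d ^ 2 < 0 →
      ∃ r₁ r₂ : ℝ, r r₁ = 0 ∧ r r₂ = 0 ∧ r₁ < 0 ∧ 0 < r₂) ∧
    (0 < A * k - 3 * d ^ 2 → d ≠ 0 → 0 < 25 * d ^ 2 - 8 * A * k →
      ∃ r₁ r₂ : ℝ, r r₁ = 0 ∧ r r₂ = 0 ∧ r₁ ≠ r₂ ∧ 0 < r₁ * r₂) ∧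
    (25 * d ^ 2 - 8 * A * k < 0 → ∀ x : ℝ, r x ≠ 0) ∧
    (k ≠ 0 → A * k - 3 * d ^ 2 ≠ 0 →
      (A * k - 3 * d ^ 2 < 0 ↔ 0 < -(2 * k ^ 2 * (A * k - 3 * d ^ 2)))) := by
  have root : ∀ s : ℝ, s ^ 2 = 25 * d ^ 2 - 8 * A * k → r ((-d + s) / 2) = 0 := by
    intro s hs
    rw [hr]
    linear_combination hs / 4
  refine ⟨?_, ?_, ?_, ?_⟩
  · intro h
    have hD : 0 ≤ 25 * d ^ 2 - 8 * A * k := by nlinarith [sq_nonneg d]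
    have hs := Real.sq_sqrt hD
    have hs0 := Real.sqrt_nonneg (25 * d ^ 2 - 8 * A * k)
    set s := Real.sqrt (25 * d ^ 2 - 8 * A * k)
    have hlt : |d| < s := abs_lt_of_sq_lt_sq (by nlinarith) hs0
    obtain ⟨h1, h2⟩ := abs_lt.mp hlt
    exact ⟨(-d + -s) / 2, (-d + s) / 2, root _ (by rw [neg_sq]; exact hs), root _ hs,
      by linarith, by linarith⟩
  · intro h _ hD
    have hs := Real.sq_sqrt hD.le
    have hs0 := Real.sqrt_pos.mpr hD
    set s := Real.sqrt (25 * d ^ 2 - 8 * A * k)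
    exact ⟨(-d + -s) / 2, (-d + s) / 2, root _ (by rw [neg_sq]; exact hs), root _ hs,
      fun e => by linarith, by nlinarith⟩
  · intro h x hx
    rw [hr] at hx
    nlinarith [sq_nonneg (2 * x + d)]
  · intro hk _
    have hk2 : 0 < 2 * k ^ 2 := by positivity
    rw [neg_pos, mul_neg_iff]
    constructor
    · intro h
      exact Or.inl ⟨hk2, h⟩
    · rintro (h | h)
      · exact h.2
      · linarith [h.1]
end

section
/- For every real number a > 0, the function s ↦ √(a/(cos s·(1 + a·cos s))) is interval integrable on [−π/2, π/2] (with respect to Lebesgue measure), even though it tends to +∞ at both endpoints; consequently ρ(a) = ∫_{−π/2}^{π/2} √(a/(cos s·(1 + a·cos s))) ds is a well-defined finite positive real number. -/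
open Real Filter MeasureTheory

theorem aux_tendsto (a : ℝ) (ha : 0 < a) (l : Filter ℝ) (h0 : Tendsto Real.cos l (nhds 0))
    (hp : ∀ᶠ s in l, 0 < Real.cos s) :
    Tendsto (fun s => Real.sqrt (a / (Real.cos s * (1 + a * Real.cos s)))) l atTop := by
  apply Real.tendsto_sqrt_atTop.comp
  have h1 : Tendsto (fun s => Real.cos s * (1 + a * Real.cos s)) l (nhds 0) := by
    have := h0.mul ((h0.const_mul a).const_add 1)
    simpa using this
  have h2 : Tendsto (fun s => Real.cos s * (1 + a * Real.cos s)) l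
      (nhdsWithin 0 (Set.Ioi 0)) := by
    refine tendsto_nhdsWithin_iff.2 ⟨h1, ?_⟩
    filter_upwards [hp] with s hs
    have : 0 < Real.cos s * (1 + a * Real.cos s) := by positivity
    exact this
  have h3 := (tendsto_inv_nhdsGT_zero.comp h2).const_mul_atTop ha
  simpa [div_eq_mul_inv, Function.comp_def] using h3

theorem aux_half (a : ℝ) (ha : 0 < a) :
    IntervalIntegrable (fun s => Real.sqrt (a / (Real.cos s * (1 + a * Real.cos s))))
        volume 0 (π / 2) := by
  have hg : IntervalIntegrable (fun s : ℝ => √(a * π / 2) * (π / 2 - s) ^ (-(1 / 2) : ℝ))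
      volume 0 (π / 2) := by
    have h := (intervalIntegral.intervalIntegrable_rpow' (a := 0) (b := π / 2)
      (r := (-(1 / 2) : ℝ)) (by norm_num)).comp_sub_left (π / 2)
    have h' := (h.symm).const_mul (√(a * π / 2))
    simpa using h'
  refine hg.mono_fun' ?_ ?_
  · apply Measurable.aestronglyMeasurable
    fun_prop
  · refine (ae_restrict_iff' measurableSet_uIoc).2 (Eventually.of_forall ?_)
    intro s hs
    rw [Set.uIoc_of_le (by positivity)] at hs
    obtain ⟨h0, h1⟩ := hs
    beta_reduce
    rw [Real.norm_of_nonneg (Real.sqrt_nonneg _)]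
    rcases h1.eq_or_lt with rfl | h1
    · simp only [Real.cos_pi_div_two, zero_mul, div_zero, Real.sqrt_zero, sub_self]
      positivity
    · have hd : 0 < π / 2 - s := by linarith
      have hc : 2 / π * (π / 2 - s) ≤ Real.cos s := by
        have := Real.mul_le_sin hd.le (by linarith)
        rwa [Real.sin_pi_div_two_sub] at this
      have hq : 0 < 2 / π * (π / 2 - s) := by positivity
      have hc0 : 0 < Real.cos s := hq.trans_le hc
      rw [Real.rpow_neg hd.le, ← Real.sqrt_eq_rpow, ← Real.sqrt_inv,
        ← Real.sqrt_mul (by positivity)]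
      apply Real.sqrt_le_sqrt
      calc a / (Real.cos s * (1 + a * Real.cos s)) ≤ a / (2 / π * (π / 2 - s)) := by
            apply div_le_div_of_nonneg_left ha.le hq
            have : 0 < a * Real.cos s * Real.cos s := by positivity
            nlinarith
        _ = a * π / 2 * (π / 2 - s)⁻¹ := by
            have := Real.pi_pos.ne'
            have := hd.ne'
            rw [div_eq_mul_inv, mul_inv, inv_div]
            ring

theorem torus_rotation_number_integrand_integrable
    (a : ℝ) (ha : 0 < a) :
    Tendsto (fun s => Real.sqrt (a / (Real.cos s * (1 + a * Real.cos s))))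
        (nhdsWithin (π / 2) (Set.Iio (π / 2))) atTop ∧
      Tendsto (fun s => Real.sqrt (a / (Real.cos s * (1 + a * Real.cos s))))
        (nhdsWithin (-(π / 2)) (Set.Ioi (-(π / 2)))) atTop ∧
      IntervalIntegrable (fun s => Real.sqrt (a / (Real.cos s * (1 + a * Real.cos s))))
        volume (-(π / 2)) (π / 2) ∧
      0 < ∫ s in (-(π / 2))..(π / 2),
        Real.sqrt (a / (Real.cos s * (1 + a * Real.cos s))) := by
  have hlt : -(π / 2) < π / 2 := by linarith [Real.pi_pos]
  have hI : IntervalIntegrable (fun s => Real.sqrt (a / (Real.cos s * (1 + a * Real.cos s))))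
        volume (-(π / 2)) (π / 2) := by
    have h := aux_half a ha
    have h2 := h.comp_sub_left 0
    simp only [zero_sub, Real.cos_neg, neg_zero] at h2
    exact h2.symm.trans h
  refine ⟨?_, ?_, hI, ?_⟩
  · apply aux_tendsto a ha
    · have := Real.continuous_cos.tendsto (π / 2)
      rw [Real.cos_pi_div_two] at this
      exact this.mono_left nhdsWithin_le_nhds
    · filter_upwards [Ioo_mem_nhdsLT hlt] with s hs
      exact Real.cos_pos_of_mem_Ioo hs
  · apply aux_tendsto a ha
    · have := Real.continuous_cos.tendsto (-(π / 2))
      rw [Real.cos_neg, Real.cos_pi_div_two] at this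
      exact this.mono_left nhdsWithin_le_nhds
    · filter_upwards [Ioo_mem_nhdsGT hlt] with s hs
      exact Real.cos_pos_of_mem_Ioo hs
  · apply intervalIntegral.intervalIntegral_pos_of_pos_on hI _ hlt
    intro s hs
    have := Real.cos_pos_of_mem_Ioo hs
    positivity
end

section
/- The function ρ defined for a > 0 by ρ(a) = ∫_{−π/2}^{π/2} √(a/(cos s·(1 + a·cos s))) ds is strictly increasing on (0, ∞) and satisfies ρ(a) > 0 for all a > 0. In particular, ρ(a) ≠ 0 and ρ is injective on (0, ∞). -/
open Real MeasureTheory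

lemma torus_bound_aux (a t c : ℝ) (ha : 0 < a) (ht : 0 < t) (hc : 2 / π * t ≤ c) :
    Real.sqrt (a / (c * (1 + a * c))) ≤ Real.sqrt (a * (π / 2)) * t ^ (-(1 / 2) : ℝ) := by
  have hpi := Real.pi_pos
  have h0 : 0 < 2 / π * t := by positivity
  have hc0 : 0 < c := lt_of_lt_of_le h0 hc
  rw [Real.rpow_neg ht.le, ← Real.sqrt_eq_rpow, ← Real.sqrt_inv,
    ← Real.sqrt_mul (by positivity)]
  apply Real.sqrt_le_sqrt
  calc a / (c * (1 + a * c)) ≤ a / (2 / π * t) := by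
        apply div_le_div_of_nonneg_left ha.le h0
        have : 0 < a * c * c := by positivity
        nlinarith
    _ = a * (π / 2) * t⁻¹ := by field_simp

lemma torus_integrable (a : ℝ) (ha : 0 < a) :
    IntervalIntegrable (fun s => Real.sqrt (a / (Real.cos s * (1 + a * Real.cos s))))
      volume (-(π / 2)) (π / 2) := by
  have hpi := Real.pi_pos
  have h1 : IntervalIntegrable (fun s : ℝ => (π / 2 - s) ^ (-(1 / 2) : ℝ)) volume
      (-(π / 2)) (π / 2) := by
    have := (intervalIntegral.intervalIntegrable_rpow' (a := π) (b := 0)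
      (r := -(1 / 2)) (by norm_num)).comp_sub_left (π / 2)
    convert this using 1 <;> ring
  have h2 : IntervalIntegrable (fun s : ℝ => (π / 2 + s) ^ (-(1 / 2) : ℝ)) volume
      (-(π / 2)) (π / 2) := by
    have := (intervalIntegral.intervalIntegrable_rpow' (a := 0) (b := π)
      (r := -(1 / 2)) (by norm_num)).comp_add_left (π / 2)
    convert this using 1 <;> ring
  refine ((h1.add h2).const_mul (Real.sqrt (a * (π / 2)))).mono_fun'
    (Measurable.aestronglyMeasurable (by fun_prop)) ?_
  refine (ae_restrict_iff' measurableSet_uIoc).2 (Filter.Eventually.of_forall ?_)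
  intro s hs
  rw [Set.uIoc_of_le (by linarith)] at hs
  obtain ⟨hs1, hs2⟩ := hs
  beta_reduce
  rw [Real.norm_of_nonneg (Real.sqrt_nonneg _), mul_add (Real.sqrt (a * (π / 2)))]
  have n1 : 0 ≤ Real.sqrt (a * (π / 2)) * (π / 2 - s) ^ (-(1 / 2) : ℝ) :=
    mul_nonneg (Real.sqrt_nonneg _) (Real.rpow_nonneg (by linarith) _)
  have n2 : 0 ≤ Real.sqrt (a * (π / 2)) * (π / 2 + s) ^ (-(1 / 2) : ℝ) :=
    mul_nonneg (Real.sqrt_nonneg _) (Real.rpow_nonneg (by linarith) _)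
  rcases le_total 0 s with h | h
  · rcases eq_or_lt_of_le hs2 with h' | h'
    · have : Real.cos s = 0 := by rw [h', Real.cos_pi_div_two]
      simp only [this, zero_mul, div_zero, Real.sqrt_zero]
      linarith
    · have := Real.mul_le_sin (x := π / 2 - s) (by linarith) (by linarith)
      rw [Real.sin_pi_div_two_sub] at this
      linarith [torus_bound_aux a _ _ ha (by linarith) this]
  · have := Real.mul_le_sin (x := π / 2 + s) (by linarith) (by linarith)
    rw [add_comm, Real.sin_add_pi_div_two, add_comm] at this
    linarith [torus_bound_aux a _ _ ha (by linarith) this]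

theorem torus_rotation_number_strictly_increasing_and_positive
    (ρ : ℝ → ℝ)
    (hρ : ∀ a, 0 < a → ρ a = ∫ s in (-(π / 2))..(π / 2),
      Real.sqrt (a / (Real.cos s * (1 + a * Real.cos s)))) :
    StrictMonoOn ρ (Set.Ioi (0 : ℝ)) ∧ (∀ a, 0 < a → 0 < ρ a) ∧
      (∀ a, 0 < a → ρ a ≠ 0) ∧ Set.InjOn ρ (Set.Ioi (0 : ℝ)) := by
  have hpi := Real.pi_pos
  have hpos : ∀ a, 0 < a → 0 < ρ a := by
    intro a ha
    rw [hρ a ha]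
    refine intervalIntegral.intervalIntegral_pos_of_pos_on (torus_integrable a ha) ?_ (by linarith)
    intro s hs
    have hc := Real.cos_pos_of_mem_Ioo hs
    positivity
  have hmono : StrictMonoOn ρ (Set.Ioi (0 : ℝ)) := by
    intro a ha b hb hab
    have ha : 0 < a := ha
    have hb : 0 < b := hb
    rw [hρ a ha, hρ b hb, ← sub_pos,
      ← intervalIntegral.integral_sub (torus_integrable b hb) (torus_integrable a ha)]
    refine intervalIntegral.intervalIntegral_pos_of_pos_on
      ((torus_integrable b hb).sub (torus_integrable a ha)) ?_ (by linarith)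
    intro s hs
    have hc := Real.cos_pos_of_mem_Ioo hs
    rw [sub_pos]
    apply Real.sqrt_lt_sqrt (by positivity)
    rw [div_lt_div_iff₀ (by positivity) (by positivity)]
    nlinarith [mul_pos (sub_pos.2 hab) hc]
  exact ⟨hmono, hpos, fun a ha => (hpos a ha).ne', hmono.injOn⟩
end
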